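/- Let n, m be integers with m ≥ 2 and n > 2m, let s > 1/2 and δ > 0. Then there exists a constant C = C(s, m, n, δ) such that for every z ∈ ℂ \ [0, ∞) with |z| ≥ δ and every Schwartz function u on ℝⁿ, ‖⟨x⟩^{−s} u‖_{L²(ℝⁿ)} ≤ C |z|^{(1−2m)/(2m)} ‖⟨x⟩^{s} ((−Δ)^m u − z u)‖_{L²(ℝⁿ)}. (This is the high-energy decay estimate ‖R₀(z)‖_{L²_s → L²_{−s}} ≤ C |z|^{(1−2m)/(2m)} for |z| ≥ δ.) -/

import Mathlib

open MeasureTheory Complex Real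
open scoped ENNReal

noncomputable section

/-- Euclidean space `ℝⁿ`. -/
abbrev Euc (n : ℕ) := EuclideanSpace ℝ (Fin n)

/-- The negative Laplacian `-Δ` acting on complex-valued functions on `ℝⁿ`. -/
def negLap {n : ℕ} (u : Euc n → ℂ) : Euc n → ℂ := fun x =>
  -∑ i : Fin n, iteratedFDeriv ℝ 2 u x ![EuclideanSpace.single i 1, EuclideanSpace.single i 1]


open scoped LineDeriv Laplacian SchwartzMap

/-- weight `(1+ε²|x|²)^a` -/
def pw {n : ℕ} (ε a : ℝ) (x : Euc n) : ℝ := (1 + ε ^ 2 * ‖x‖ ^ 2) ^ a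

/-- weighted bilinear form -/
def BF {n : ℕ} (φ : Euc n → ℝ) (u v : 𝓢(Euc n, ℂ)) : ℝ := ∫ x, φ x * inner ℝ (u x) (v x)

/-- standard basis vector -/
abbrev ev {n : ℕ} (i : Fin n) : Euc n := EuclideanSpace.single i 1

lemma pw_tg {n : ℕ} (ε a : ℝ) : (pw (n := n) ε a).HasTemperateGrowth := by
  have h := (Function.hasTemperateGrowth_one_add_norm_sq_rpow (Euc n) a).comp
    (ContinuousLinearMap.hasTemperateGrowth (ε • ContinuousLinearMap.id ℝ (Euc n)))
  have he : pw (n := n) ε a = (fun x : Euc n => (1 + ‖x‖ ^ 2) ^ a) ∘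
      (ε • ContinuousLinearMap.id ℝ (Euc n)) := by
    funext x
    simp [pw, norm_smul, mul_pow]
  rw [he]
  exact h

lemma coord_tg {n : ℕ} (i : Fin n) : (fun x : Euc n => x i).HasTemperateGrowth :=
  (EuclideanSpace.proj i : Euc n →L[ℝ] ℝ).hasTemperateGrowth

lemma BF_integrable {n : ℕ} {φ : Euc n → ℝ} (hφ : φ.HasTemperateGrowth) (u v : 𝓢(Euc n, ℂ)) :
    Integrable (fun x => φ x * inner ℝ (u x) (v x)) := by
  have h := (SchwartzMap.bilinLeftCLM (innerSL ℝ (E := ℂ)) v.hasTemperateGrowth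
    (SchwartzMap.smulLeftCLM ℂ φ u)).integrable (μ := volume)
  refine h.congr (Filter.Eventually.of_forall fun x => ?_)
  rw [SchwartzMap.bilinLeftCLM_apply]
  dsimp only
  rw [innerSL_apply_apply, SchwartzMap.smulLeftCLM_apply_apply hφ, real_inner_smul_left]

lemma BF_symm {n : ℕ} (φ : Euc n → ℝ) (u v : 𝓢(Euc n, ℂ)) : BF φ u v = BF φ v u := by
  unfold BF; congr 1; ext x; rw [real_inner_comm]

lemma BF_add_weight {n : ℕ} {φ ψ : Euc n → ℝ} (hφ : φ.HasTemperateGrowth)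
    (hψ : ψ.HasTemperateGrowth) (u v : 𝓢(Euc n, ℂ)) :
    BF (fun x => φ x + ψ x) u v = BF φ u v + BF ψ u v := by
  unfold BF
  rw [← integral_add (BF_integrable hφ u v) (BF_integrable hψ u v)]
  congr 1; ext x; ring

lemma BF_smul_weight {n : ℕ} (c : ℝ) (φ : Euc n → ℝ) (u v : 𝓢(Euc n, ℂ)) :
    BF (fun x => c * φ x) u v = c * BF φ u v := by
  unfold BF
  rw [← integral_const_mul]
  congr 1; ext x; ring

lemma BF_add_left {n : ℕ} {φ : Euc n → ℝ} (hφ : φ.HasTemperateGrowth) (u u' v : 𝓢(Euc n, ℂ)) :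
    BF φ (u + u') v = BF φ u v + BF φ u' v := by
  unfold BF
  rw [← integral_add (BF_integrable hφ u v) (BF_integrable hφ u' v)]
  congr 1; ext x; simp only [_root_.add_apply, inner_add_left]; ring

lemma BF_smul_left {n : ℕ} (φ : Euc n → ℝ) (c : ℝ) (u v : 𝓢(Euc n, ℂ)) :
    BF φ (c • u) v = c * BF φ u v := by
  unfold BF
  rw [← integral_const_mul]
  congr 1; ext x; simp only [_root_.smul_apply, inner_smul_left]; simp; ring

lemma BF_neg_left {n : ℕ} (φ : Euc n → ℝ) (u v : 𝓢(Euc n, ℂ)) :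
    BF φ (-u) v = - BF φ u v := by
  have := BF_smul_left φ (-1) u v
  simpa using this

lemma BF_zero_left {n : ℕ} (φ : Euc n → ℝ) (v : 𝓢(Euc n, ℂ)) :
    BF φ 0 v = 0 := by
  have := BF_smul_left φ 0 0 v
  simpa using this

lemma BF_sum_left {n : ℕ} {ι : Type*} {φ : Euc n → ℝ} (hφ : φ.HasTemperateGrowth) (s : Finset ι)
    (u : ι → 𝓢(Euc n, ℂ)) (v : 𝓢(Euc n, ℂ)) :
    BF φ (∑ i ∈ s, u i) v = ∑ i ∈ s, BF φ (u i) v := by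
  classical
  induction s using Finset.induction_on with
  | empty => simp [BF_zero_left]
  | insert a s ha ih => rw [Finset.sum_insert ha, Finset.sum_insert ha, BF_add_left hφ, ih]

lemma BF_mono {n : ℕ} {φ ψ : Euc n → ℝ} (hφ : φ.HasTemperateGrowth)
    (hψ : ψ.HasTemperateGrowth) (h : ∀ x, φ x ≤ ψ x) (u : 𝓢(Euc n, ℂ)) :
    BF φ u u ≤ BF ψ u u := by
  unfold BF
  refine integral_mono (BF_integrable hφ u u) (BF_integrable hψ u u) fun x => ?_
  exact mul_le_mul_of_nonneg_right (h x) real_inner_self_nonneg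

lemma BF_nonneg {n : ℕ} {φ : Euc n → ℝ} (h : ∀ x, 0 ≤ φ x) (u : 𝓢(Euc n, ℂ)) :
    0 ≤ BF φ u u :=
  integral_nonneg fun x => mul_nonneg (h x) real_inner_self_nonneg

lemma BF_abs_le {n : ℕ} {φ ψ : Euc n → ℝ} (hφ : φ.HasTemperateGrowth)
    (hψ : ψ.HasTemperateGrowth) (K : ℝ) (h : ∀ x, |φ x| ≤ K * ψ x) (u : 𝓢(Euc n, ℂ)) :
    |BF φ u u| ≤ K * BF ψ u u := by
  rw [← BF_smul_weight, abs_le, neg_le, ← neg_one_mul, ← BF_smul_weight]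
  have hK : (fun x => K * ψ x).HasTemperateGrowth := by fun_prop
  have hN : (fun x => (-1) * φ x).HasTemperateGrowth := by fun_prop
  exact ⟨BF_mono hN hK (fun x => by have := (abs_le.1 (h x)).1; linarith) u,
    BF_mono hφ hK (fun x => (abs_le.1 (h x)).2) u⟩

lemma BF_cs {n : ℕ} {φ ψ χ : Euc n → ℝ} (hφ : φ.HasTemperateGrowth)
    (hψ : ψ.HasTemperateGrowth) (hχ : χ.HasTemperateGrowth) (K : ℝ) (hK : 0 ≤ K)
    (hψ0 : ∀ x, 0 ≤ ψ x) (hχ0 : ∀ x, 0 ≤ χ x)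
    (h : ∀ x, |φ x| ≤ K * (√(ψ x) * √(χ x))) (u v : 𝓢(Euc n, ℂ)) :
    |BF φ u v| ≤ K * (√(BF ψ u u) * √(BF χ v v)) := by
  have key : ∀ t : ℝ, 0 < t → |BF φ u v| ≤ K / 2 * (t * BF ψ u u + t⁻¹ * BF χ v v) := by
    intro t ht
    have hψi := BF_integrable hψ u u
    have hχi := BF_integrable hχ v v
    unfold BF
    rw [← integral_const_mul, ← integral_const_mul, ← integral_add (hψi.const_mul _)
      (hχi.const_mul _), ← integral_const_mul]
    refine (abs_integral_le_integral_abs).trans ?_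
    refine integral_mono (BF_integrable hφ u v).abs (((hψi.const_mul _).add
      (hχi.const_mul _)).const_mul _) fun x => ?_
    simp only [real_inner_self_eq_norm_sq, abs_mul]
    have h1 := abs_real_inner_le_norm (u x) (v x)
    have h2 := h x
    have h3 : 0 ≤ ‖u x‖ * ‖v x‖ := by positivity
    have h4 : 2 * (√(ψ x) * √(χ x) * (‖u x‖ * ‖v x‖)) ≤
        t * (ψ x * ‖u x‖ ^ 2) + t⁻¹ * (χ x * ‖v x‖ ^ 2) := by
      have e1 := Real.sq_sqrt (hψ0 x)
      have e2 := Real.sq_sqrt (hχ0 x)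
      have e3 := Real.sq_sqrt ht.le
      have e4 : (√t)⁻¹ ^ 2 = t⁻¹ := by rw [inv_pow, e3]
      have e5 : √t * (√t)⁻¹ = 1 := mul_inv_cancel₀ (by positivity)
      have := sq_nonneg (√t * √(ψ x) * ‖u x‖ - (√t)⁻¹ * √(χ x) * ‖v x‖)
      have e6 : (√t * √(ψ x) * ‖u x‖ - (√t)⁻¹ * √(χ x) * ‖v x‖) ^ 2 =
        (√t)^2 * (√(ψ x)^2 * ‖u x‖^2) + (√t)⁻¹ ^ 2 * (√(χ x)^2 * ‖v x‖^2)
        - 2 * (√t * (√t)⁻¹) * (√(ψ x) * √(χ x) * (‖u x‖ * ‖v x‖)) := by ring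
      rw [e6, e1, e2, e3, e4, e5] at this
      linarith
    calc |φ x| * |inner ℝ (u x) (v x)| ≤ K * (√(ψ x) * √(χ x)) * (‖u x‖ * ‖v x‖) := by gcongr
      _ = K / 2 * (2 * (√(ψ x) * √(χ x) * (‖u x‖ * ‖v x‖))) := by ring
      _ ≤ _ := by gcongr
  have hA := BF_nonneg hψ0 u
  have hD := BF_nonneg hχ0 v
  set A := BF ψ u u
  set D := BF χ v v
  have key2 : ∀ e : ℝ, 0 < e → |BF φ u v| ≤ K * (√(A + e) * √(D + e)) := by
    intro e he
    have hA' : 0 < √(A + e) := Real.sqrt_pos.2 (by linarith)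
    have hD' : 0 < √(D + e) := Real.sqrt_pos.2 (by linarith)
    have := key (√(D + e) / √(A + e)) (by positivity)
    have e1 := Real.sq_sqrt (show 0 ≤ A + e by linarith)
    have e2 := Real.sq_sqrt (show 0 ≤ D + e by linarith)
    have l1 : √(D + e) / √(A + e) * A ≤ √(A + e) * √(D + e) := by
      rw [div_mul_eq_mul_div, div_le_iff₀ hA']
      nlinarith
    have l2 : (√(D + e) / √(A + e))⁻¹ * D ≤ √(A + e) * √(D + e) := by
      rw [inv_div, div_mul_eq_mul_div, div_le_iff₀ hD']
      nlinarith
    nlinarith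
  have ht : Filter.Tendsto (fun e : ℝ => K * (√(A + e) * √(D + e))) (nhdsWithin 0 (Set.Ioi 0))
      (nhds (K * (√(A + 0) * √(D + 0)))) := by
    apply tendsto_nhdsWithin_of_tendsto_nhds
    apply Continuous.tendsto
    fun_prop
  rw [add_zero, add_zero] at ht
  exact ge_of_tendsto ht (by filter_upwards [self_mem_nhdsWithin] with e he using key2 e he)

lemma BF_ibp {n : ℕ} {φ φ' : Euc n → ℝ} (hφ : φ.HasTemperateGrowth)
    (hφ' : φ'.HasTemperateGrowth) (e : Euc n) (h : ∀ x, HasLineDerivAt ℝ φ (φ' x) x e)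
    (u v : 𝓢(Euc n, ℂ)) :
    BF φ (∂_{e} u) v + BF φ u (∂_{e} v) + BF φ' u v = 0 := by
  have key := SchwartzMap.integral_bilinear_lineDerivOp_right_eq_neg_left (μ := volume)
    (SchwartzMap.smulLeftCLM ℂ φ u) v (innerSL ℝ (E := ℂ)) e
  have hd : ∀ x, ∂_{e} (SchwartzMap.smulLeftCLM ℂ φ u) x = φ x • ∂_{e} u x + φ' x • u x := by
    intro x
    rw [SchwartzMap.lineDerivOp_apply]
    apply HasLineDerivAt.lineDeriv
    have h2 : HasLineDerivAt ℝ u (∂_{e} u x) x e := by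
      rw [SchwartzMap.lineDerivOp_apply_eq_fderiv]
      exact u.differentiableAt.hasFDerivAt.hasLineDerivAt e
    have h3 := HasDerivAt.smul (h x) h2
    simp only [zero_smul, add_zero] at h3
    unfold HasLineDerivAt
    refine h3.congr_of_eventuallyEq (Filter.Eventually.of_forall fun t => ?_)
    simp [SchwartzMap.smulLeftCLM_apply_apply hφ]
  have e1 : (∫ x, (innerSL ℝ (E := ℂ)) (SchwartzMap.smulLeftCLM ℂ φ u x) (∂_{e} v x)) =
      BF φ u (∂_{e} v) := by
    unfold BF; congr 1; ext x
    rw [innerSL_apply_apply, SchwartzMap.smulLeftCLM_apply_apply hφ, real_inner_smul_left]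
  have e2 : (∫ x, (innerSL ℝ (E := ℂ)) (∂_{e} (SchwartzMap.smulLeftCLM ℂ φ u) x) (v x)) =
      BF φ (∂_{e} u) v + BF φ' u v := by
    unfold BF; rw [← integral_add (BF_integrable hφ _ v) (BF_integrable hφ' u v)]
    congr 1; ext x
    rw [hd, innerSL_apply_apply, inner_add_left, real_inner_smul_left, real_inner_smul_left]
  rw [e1, e2] at key
  linarith


lemma one_le_q {n : ℕ} (ε : ℝ) (x : Euc n) : 1 ≤ 1 + ε ^ 2 * ‖x‖ ^ 2 := by
  have : 0 ≤ ε ^ 2 * ‖x‖ ^ 2 := by positivity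
  linarith

lemma pw_pos {n : ℕ} (ε a : ℝ) (x : Euc n) : 0 < pw ε a x :=
  Real.rpow_pos_of_pos (by have := one_le_q ε x; linarith) _

lemma pw_le {n : ℕ} (ε : ℝ) {a b : ℝ} (h : a ≤ b) (x : Euc n) : pw ε a x ≤ pw ε b x :=
  Real.rpow_le_rpow_of_exponent_le (one_le_q ε x) h

lemma pw_zero {n : ℕ} (ε : ℝ) (x : Euc n) : pw ε 0 x = 1 := by simp [pw]

lemma pw_mul_q {n : ℕ} (ε a : ℝ) (x : Euc n) :
    (1 + ε ^ 2 * ‖x‖ ^ 2) * pw ε (a - 1) x = pw ε a x := by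
  have := one_le_q ε x
  have h0 : 0 < 1 + ε ^ 2 * ‖x‖ ^ 2 := by linarith
  unfold pw
  rw [Real.rpow_sub_one h0.ne']
  field_simp

lemma coord_sq_le {n : ℕ} (x : Euc n) (i : Fin n) : x i ^ 2 ≤ ‖x‖ ^ 2 := by
  rw [EuclideanSpace.norm_sq_eq]
  have := Finset.single_le_sum (f := fun i => ‖x i‖ ^ 2) (fun i _ => by positivity)
    (Finset.mem_univ i)
  simpa using this

/-- first derivative of the weight -/
def dpw {n : ℕ} (ε a : ℝ) (i : Fin n) (x : Euc n) : ℝ := 2 * a * ε ^ 2 * (x i * pw ε (a - 1) x)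

lemma coord_line {n : ℕ} (i j : Fin n) (x : Euc n) :
    HasLineDerivAt ℝ (fun x : Euc n => x j) (if j = i then 1 else 0) x (ev i) := by
  unfold HasLineDerivAt
  have : (fun t : ℝ => (x + t • ev i) j) = fun t => x j + t * (if j = i then 1 else 0) := by
    funext t
    simp [ev]
  rw [this]
  simpa using ((hasDerivAt_id (0 : ℝ)).mul_const (if j = i then (1 : ℝ) else 0)).const_add (x j)

lemma pw_line {n : ℕ} (ε a : ℝ) (i : Fin n) (x : Euc n) :
    HasLineDerivAt ℝ (pw ε a) (dpw ε a i x) x (ev i) := by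
  unfold HasLineDerivAt
  have h0 := one_le_q ε x
  have e : ∀ t : ℝ, ‖x + t • ev i‖ ^ 2 = ‖x‖ ^ 2 + 2 * (t * x i) + t ^ 2 := by
    intro t
    rw [norm_add_sq_real]
    simp [ev, inner_smul_right, norm_smul, EuclideanSpace.inner_single_right]
  have h1 : HasDerivAt (fun t : ℝ => 1 + ε ^ 2 * ‖x + t • ev i‖ ^ 2) (ε ^ 2 * (2 * x i)) 0 := by
    simp_rw [e]
    have hA : HasDerivAt (fun t : ℝ => ‖x‖ ^ 2 + 2 * (t * x i) + t ^ 2)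
        (2 * (1 * x i) + (2 : ℕ) * (0 : ℝ) ^ (2 - 1) * 1) 0 :=
      ((((hasDerivAt_id (0 : ℝ)).mul_const (x i)).const_mul 2).const_add (‖x‖ ^ 2)).add
        ((hasDerivAt_id (0 : ℝ)).pow 2)
    have := (hA.const_mul (ε ^ 2)).const_add 1
    simpa using this
  have h2 := h1.rpow_const (p := a) (Or.inl (by simp; linarith))
  convert! h2 using 1
  simp only [dpw, pw, zero_smul, add_zero]
  ring

lemma dpw_tg {n : ℕ} (ε a : ℝ) (i : Fin n) : (dpw ε a i).HasTemperateGrowth := by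
  have h1 := coord_tg i
  have h2 := pw_tg (n := n) ε (a - 1)
  unfold dpw
  fun_prop

/-- second derivative of the weight -/
def ddpw {n : ℕ} (ε a : ℝ) (i : Fin n) (x : Euc n) : ℝ :=
  2 * a * ε ^ 2 * (pw ε (a - 1) x + x i * dpw ε (a - 1) i x)

lemma ddpw_tg {n : ℕ} (ε a : ℝ) (i : Fin n) : (ddpw ε a i).HasTemperateGrowth := by
  have h1 := coord_tg i
  have h2 := pw_tg (n := n) ε (a - 1)
  have h3 := dpw_tg (n := n) ε (a - 1) i
  unfold ddpw
  fun_prop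

lemma HasLineDerivAt_mul {n : ℕ} {f g : Euc n → ℝ} {f' g' : ℝ} {x e : Euc n}
    (hf : HasLineDerivAt ℝ f f' x e) (hg : HasLineDerivAt ℝ g g' x e) :
    HasLineDerivAt ℝ (fun x => f x * g x) (f' * g x + f x * g') x e := by
  have := HasDerivAt.mul hf hg
  simpa [HasLineDerivAt] using! this

lemma dpw_line {n : ℕ} (ε a : ℝ) (i : Fin n) (x : Euc n) :
    HasLineDerivAt ℝ (dpw ε a i) (ddpw ε a i x) x (ev i) := by
  have h := HasLineDerivAt_mul (coord_line i i x) (pw_line ε (a - 1) i x)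
  have h2 := HasDerivAt.const_mul (2 * a * ε ^ 2) h
  have e : ddpw ε a i x = 2 * a * ε ^ 2 * ((if i = i then 1 else 0) * pw ε (a - 1) x +
      x i * dpw ε (a - 1) i x) := by simp [ddpw]
  rw [e]
  exact h2

lemma ddpw_le {n : ℕ} (ε a : ℝ) (i : Fin n) (x : Euc n) :
    |ddpw ε a i x| ≤ (2 * |a| + 4 * |a| * |a - 1|) * ε ^ 2 * pw ε (a - 1) x := by
  have hp := pw_pos ε (a - 1) x
  have hp2 := pw_pos ε (a - 1 - 1) x
  have h1 := pw_mul_q ε (a - 1) x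
  have h2 : ε ^ 2 * (x i) ^ 2 * pw ε (a - 1 - 1) x ≤ pw ε (a - 1) x := by
    rw [← h1]
    apply mul_le_mul_of_nonneg_right _ hp2.le
    have := mul_le_mul_of_nonneg_left (coord_sq_le x i) (sq_nonneg ε)
    linarith
  have h3 : 0 ≤ ε ^ 2 * (x i) ^ 2 * pw ε (a - 1 - 1) x := by positivity
  have e : ddpw ε a i x = 2 * a * ε ^ 2 * (pw ε (a - 1) x +
    2 * (a - 1) * (ε ^ 2 * (x i) ^ 2 * pw ε (a - 1 - 1) x)) := by
    unfold ddpw dpw; ring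
  rw [e, abs_mul]
  have e2 : |2 * a * ε ^ 2| = 2 * |a| * ε ^ 2 := by
    rw [abs_mul, abs_mul, abs_two, abs_of_nonneg (sq_nonneg ε)]
  rw [e2]
  have h4 : |pw ε (a - 1) x + 2 * (a - 1) * (ε ^ 2 * (x i) ^ 2 * pw ε (a - 1 - 1) x)| ≤
      pw ε (a - 1) x + 2 * |a - 1| * pw ε (a - 1) x := by
    refine (abs_add_le _ _).trans ?_
    rw [abs_of_pos hp, abs_mul, abs_mul, abs_two, abs_of_nonneg h3]
    gcongr
  calc _ ≤ 2 * |a| * ε ^ 2 * (pw ε (a - 1) x + 2 * |a - 1| * pw ε (a - 1) x) := by gcongr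
    _ = _ := by ring

/-- partial derivative -/
abbrev Dd {n : ℕ} (i : Fin n) (u : 𝓢(Euc n, ℂ)) : 𝓢(Euc n, ℂ) := ∂_{ev i} u

/-- `-Δ` on Schwartz functions. -/
def AL {n : ℕ} (u : 𝓢(Euc n, ℂ)) : 𝓢(Euc n, ℂ) := - ∑ i, Dd i (Dd i u)

lemma BF_AL {n : ℕ} {φ : Euc n → ℝ} (hφ : φ.HasTemperateGrowth) {φ' : Fin n → Euc n → ℝ}
    (hφ' : ∀ i, (φ' i).HasTemperateGrowth) (h : ∀ i x, HasLineDerivAt ℝ φ (φ' i x) x (ev i))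
    (u v : 𝓢(Euc n, ℂ)) :
    BF φ (AL u) v = ∑ i, BF φ (Dd i u) (Dd i v) + ∑ i, BF (φ' i) (Dd i u) v := by
  unfold AL
  rw [BF_neg_left, BF_sum_left hφ, ← Finset.sum_add_distrib, ← Finset.sum_neg_distrib]
  refine Finset.sum_congr rfl fun i _ => ?_
  have := BF_ibp hφ (hφ' i) (ev i) (h i) (Dd i u) v
  linarith

lemma BF_one_AL {n : ℕ} (u v : 𝓢(Euc n, ℂ)) :
    BF (fun _ => 1) (AL u) v = ∑ i, BF (fun _ => 1) (Dd i u) (Dd i v) := by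
  have h0 : ∀ x i, HasLineDerivAt ℝ (fun _ : Euc n => (1 : ℝ)) 0 x (ev i) := by
    intro x i; exact hasDerivAt_const _ _
  rw [BF_AL (φ' := fun _ _ => 0) (by fun_prop) (by intro i; fun_prop) (fun i x => h0 x i)]
  simp [BF]

lemma BF_pw_AL {n : ℕ} (ε a b : ℝ) (hab : a - 1 ≤ b) (u : 𝓢(Euc n, ℂ)) :
    |BF (pw ε a) (AL u) u - ∑ i, BF (pw ε a) (Dd i u) (Dd i u)| ≤
      n * (2 * |a| + 4 * |a| * |a - 1|) * ε ^ 2 * BF (pw ε b) u u := by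
  rw [BF_AL (pw_tg ε a) (dpw_tg ε a) (pw_line ε a), add_sub_cancel_left]
  refine (Finset.abs_sum_le_sum_abs _ _).trans ?_
  have : ∀ i ∈ Finset.univ, |BF (dpw ε a i) (Dd i u) u| ≤
      (2 * |a| + 4 * |a| * |a - 1|) * ε ^ 2 * BF (pw ε b) u u := by
    intro i _
    have h := BF_ibp (dpw_tg ε a i) (ddpw_tg ε a i) (ev i) (dpw_line ε a i) u u
    rw [BF_symm _ u (Dd i u)] at h
    have h2 := BF_abs_le (ddpw_tg ε a i) (pw_tg ε b) ((2 * |a| + 4 * |a| * |a - 1|) * ε ^ 2)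
      (fun x => (ddpw_le ε a i x).trans (by gcongr; exact pw_le ε hab x)) u
    have h3 : BF (dpw ε a i) (Dd i u) u = - BF (ddpw ε a i) u u / 2 := by linarith
    rw [h3, abs_div, abs_neg, abs_two]
    have := abs_nonneg (BF (ddpw ε a i) u u)
    linarith
  refine (Finset.sum_le_card_nsmul _ _ _ this).trans ?_
  simp [mul_assoc]


lemma Dd_apply2 {n : ℕ} (i j : Fin n) (u : 𝓢(Euc n, ℂ)) (x : Euc n) :
    Dd i (Dd j u) x = iteratedFDeriv ℝ 2 u x ![ev i, ev j] := by
  rw [← SchwartzMap.iteratedLineDerivOp_eq_iteratedFDeriv,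
    LineDeriv.iteratedLineDerivOp_succ_left, LineDeriv.iteratedLineDerivOp_one]
  rfl

lemma Dd_comm {n : ℕ} (i j : Fin n) (u : 𝓢(Euc n, ℂ)) : Dd i (Dd j u) = Dd j (Dd i u) := by
  ext x
  rw [Dd_apply2, Dd_apply2]
  have h : ContDiffAt ℝ 2 u x := (u.smooth 2).contDiffAt
  have h2 := (h.isSymmSndFDerivAt (by simp)).iteratedFDeriv_cons (v := ev i) (w := ev j)
  exact h2

lemma negLap_eq {n : ℕ} (u : 𝓢(Euc n, ℂ)) : negLap (⇑u) = ⇑(AL u) := by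
  funext x
  unfold negLap AL
  rw [_root_.neg_apply, _root_.sum_apply]
  congr 1
  refine Finset.sum_congr rfl fun i _ => ?_
  rw [Dd_apply2]

lemma morawetz {n : ℕ} {X : Fin n → Euc n → ℝ} {dX : Fin n → Fin n → Euc n → ℝ}
    {dv : Euc n → ℝ}
    (hX : ∀ j, (X j).HasTemperateGrowth) (hdX : ∀ i j, (dX i j).HasTemperateGrowth)
    (h : ∀ i j x, HasLineDerivAt ℝ (X j) (dX i j x) x (ev i))
    (hdv : ∀ x, dv x = ∑ j, dX j j x) (u : 𝓢(Euc n, ℂ)) :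
    ∑ j, BF (X j) (AL u) (Dd j u) = ∑ j, ∑ i, BF (dX i j) (Dd i u) (Dd j u) -
      1 / 2 * ∑ i, BF dv (Dd i u) (Dd i u) := by
  have h1 : ∀ j, BF (X j) (AL u) (Dd j u) = ∑ i, BF (X j) (Dd i u) (Dd j (Dd i u)) +
      ∑ i, BF (dX i j) (Dd i u) (Dd j u) := by
    intro j
    rw [BF_AL (hX j) (fun i => hdX i j) (fun i => h i j)]
    simp_rw [Dd_comm j]
  have h2 : ∀ i j, BF (X j) (Dd i u) (Dd j (Dd i u)) = -(1 / 2) * BF (dX j j) (Dd i u) (Dd i u) := by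
    intro i j
    have := BF_ibp (hX j) (hdX j j) (ev j) (h j j) (Dd i u) (Dd i u)
    rw [BF_symm _ (∂_{ev j} (Dd i u))] at this
    change BF (X j) (Dd i u) (Dd j (Dd i u)) + BF (X j) (Dd i u) (Dd j (Dd i u)) + _ = 0 at this
    linarith
  have h3 : ∀ i, BF dv (Dd i u) (Dd i u) = ∑ j, BF (dX j j) (Dd i u) (Dd i u) := by
    intro i
    unfold BF
    rw [← integral_finsetSum _ (fun j _ => BF_integrable (hdX j j) _ _)]
    congr 1; ext x; rw [hdv, Finset.sum_mul]
  simp_rw [h1, h2, h3, Finset.sum_add_distrib]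
  rw [Finset.sum_comm, Finset.mul_sum]
  simp_rw [Finset.mul_sum]
  simp only [neg_mul, Finset.sum_neg_distrib]
  ring

/-- radial profile -/
def rho {n : ℕ} (ε σ : ℝ) (x : Euc n) : ℝ := 2 * pw ε (-1 / 2) x - pw ε (-(1 + σ) / 2) x
/-- derivative of the radial profile -/
def drho {n : ℕ} (ε σ : ℝ) (i : Fin n) (x : Euc n) : ℝ :=
  2 * dpw ε (-1 / 2) i x - dpw ε (-(1 + σ) / 2) i x
/-- the multiplier vector field -/
def XX {n : ℕ} (ε σ : ℝ) (j : Fin n) (x : Euc n) : ℝ := x j * rho ε σ x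
/-- its derivatives -/
def dXX {n : ℕ} (ε σ : ℝ) (i j : Fin n) (x : Euc n) : ℝ :=
  (if j = i then 1 else 0) * rho ε σ x + x j * drho ε σ i x
/-- its divergence -/
def dvX {n : ℕ} (ε σ : ℝ) (x : Euc n) : ℝ :=
  ((2 * n - 2) * pw ε (-1 / 2) x + 2 * pw ε (-1 / 2 - 1) x) +
  ((1 + σ - n) * pw ε (-(1 + σ) / 2) x + (-(1 + σ)) * pw ε (-(1 + σ) / 2 - 1) x)

lemma rho_tg {n : ℕ} (ε σ : ℝ) : (rho (n := n) ε σ).HasTemperateGrowth := by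
  have h1 := pw_tg (n := n) ε (-1 / 2)
  have h2 := pw_tg (n := n) ε (-(1 + σ) / 2)
  unfold rho; fun_prop

lemma drho_tg {n : ℕ} (ε σ : ℝ) (i : Fin n) : (drho (n := n) ε σ i).HasTemperateGrowth := by
  have h1 := dpw_tg (n := n) ε (-1 / 2) i
  have h2 := dpw_tg (n := n) ε (-(1 + σ) / 2) i
  unfold drho; fun_prop

lemma XX_tg {n : ℕ} (ε σ : ℝ) (i : Fin n) : (XX (n := n) ε σ i).HasTemperateGrowth := by
  have h1 := coord_tg i
  have h2 := rho_tg (n := n) ε σ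
  unfold XX; fun_prop

lemma dXX_tg {n : ℕ} (ε σ : ℝ) (i j : Fin n) : (dXX (n := n) ε σ i j).HasTemperateGrowth := by
  have h1 := coord_tg j
  have h2 := rho_tg (n := n) ε σ
  have h3 := drho_tg (n := n) ε σ i
  unfold dXX; fun_prop

lemma dvX_tg {n : ℕ} (ε σ : ℝ) : (dvX (n := n) ε σ).HasTemperateGrowth := by
  have h1 := pw_tg (n := n) ε (-1 / 2)
  have h2 := pw_tg (n := n) ε (-(1 + σ) / 2)
  have h3 := pw_tg (n := n) ε (-1 / 2 - 1)
  have h4 := pw_tg (n := n) ε (-(1 + σ) / 2 - 1)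
  unfold dvX; fun_prop

lemma rho_line {n : ℕ} (ε σ : ℝ) (i : Fin n) (x : Euc n) :
    HasLineDerivAt ℝ (rho ε σ) (drho ε σ i x) x (ev i) :=
  HasDerivAt.sub (HasDerivAt.const_mul 2 (pw_line ε (-1 / 2) i x)) (pw_line ε (-(1 + σ) / 2) i x)

lemma XX_line {n : ℕ} (ε σ : ℝ) (i j : Fin n) (x : Euc n) :
    HasLineDerivAt ℝ (XX ε σ j) (dXX ε σ i j x) x (ev i) :=
  HasLineDerivAt_mul (coord_line i j x) (rho_line ε σ i x)

lemma sum_coord_dpw {n : ℕ} (ε a : ℝ) (x : Euc n) :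
    ∑ i, x i * dpw ε a i x = 2 * a * (pw ε a x - pw ε (a - 1) x) := by
  have h1 := pw_mul_q ε a x
  have h2 : ∑ i, x i * dpw ε a i x = 2 * a * ε ^ 2 * pw ε (a - 1) x * ∑ i, x i ^ 2 := by
    rw [Finset.mul_sum]
    refine Finset.sum_congr rfl fun i _ => ?_
    unfold dpw; ring
  have h3 : ∑ i, x i ^ 2 = ‖x‖ ^ 2 := by
    rw [EuclideanSpace.norm_sq_eq]; simp
  rw [h2, h3, ← h1]; ring

lemma dvX_eq {n : ℕ} (ε σ : ℝ) (x : Euc n) : dvX ε σ x = ∑ j, dXX ε σ j j x := by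
  unfold dXX drho
  simp only [if_true, one_mul, Finset.sum_add_distrib, Finset.sum_const, Finset.card_univ,
    Fintype.card_fin, nsmul_eq_mul]
  have e : ∑ i, x i * (2 * dpw ε (-1 / 2) i x - dpw ε (-(1 + σ) / 2) i x) =
    2 * ∑ i, x i * dpw ε (-1 / 2) i x - ∑ i, x i * dpw ε (-(1 + σ) / 2) i x := by
    rw [Finset.mul_sum, ← Finset.sum_sub_distrib]
    refine Finset.sum_congr rfl fun i _ => ?_
    ring
  rw [e, sum_coord_dpw, sum_coord_dpw]
  unfold dvX rho
  ring

/-- pointwise positivity -/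
lemma dXX_pos {n : ℕ} (ε σ : ℝ) (hσ : 0 < σ) (hσ1 : σ ≤ 1) (x : Euc n) (p : Fin n → ℂ) :
    σ * (pw ε (-(1 + σ) / 2) x * ∑ i, ‖p i‖ ^ 2) ≤
      ∑ j, ∑ i, dXX ε σ i j x * inner ℝ (p i) (p j) := by
  set τ : ℝ := -2 * pw ε (-1 / 2 - 1) x + (1 + σ) * pw ε (-(1 + σ) / 2 - 1) x with hτ
  have hd : ∀ i, drho ε σ i x = ε ^ 2 * x i * τ := by
    intro i; unfold drho dpw; rw [hτ]; ring
  have hsum : ∑ j, ∑ i, dXX ε σ i j x * inner ℝ (p i) (p j) =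
      rho ε σ x * ∑ i, ‖p i‖ ^ 2 + ε ^ 2 * τ * ‖∑ i, x i • p i‖ ^ 2 := by
    rw [← real_inner_self_eq_norm_sq, sum_inner]
    simp_rw [inner_sum, real_inner_smul_left, real_inner_smul_right, Finset.mul_sum]
    rw [Finset.sum_comm (f := fun i j => ε ^ 2 * τ * (x i * (x j * inner ℝ (p i) (p j)))),
      ← Finset.sum_add_distrib]
    refine Finset.sum_congr rfl fun j _ => ?_
    have : rho ε σ x * ‖p j‖ ^ 2 = ∑ i, (if j = i then 1 else 0) * rho ε σ x * inner ℝ (p i) (p j) := by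
      rw [Finset.sum_eq_single j]
      · simp
      · intro b _ hb; simp [Ne.symm hb]
      · simp
    rw [this, ← Finset.sum_add_distrib]
    refine Finset.sum_congr rfl fun i _ => ?_
    unfold dXX; rw [hd]; ring
  have hcs : ‖∑ i, x i • p i‖ ^ 2 ≤ ‖x‖ ^ 2 * ∑ i, ‖p i‖ ^ 2 := by
    have h1 : ‖∑ i, x i • p i‖ ≤ ∑ i, |x i| * ‖p i‖ := by
      refine (norm_sum_le _ _).trans (le_of_eq ?_)
      simp [norm_smul]
    have h2 := Finset.sum_mul_sq_le_sq_mul_sq Finset.univ (fun i => |x i|) (fun i => ‖p i‖)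
    have h3 : ∑ i, |x i| ^ 2 = ‖x‖ ^ 2 := by
      rw [EuclideanSpace.norm_sq_eq]; simp
    rw [h3] at h2
    exact (pow_le_pow_left₀ (norm_nonneg _) h1 2).trans h2
  have hS : 0 ≤ ∑ i, ‖p i‖ ^ 2 := Finset.sum_nonneg fun i _ => by positivity
  set S := ∑ i, ‖p i‖ ^ 2
  have a1 := pw_pos ε (-1 / 2 - 1) x
  have a2 := pw_pos ε (-(1 + σ) / 2 - 1) x
  have a3 : pw ε (-(1 + σ) / 2 - 1) x ≤ pw ε (-1 / 2 - 1) x := pw_le ε (by linarith) x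
  have b1 := pw_mul_q ε (-1 / 2) x
  have b2 := pw_mul_q ε (-(1 + σ) / 2) x
  have hτ0 : τ ≤ 0 := by rw [hτ]; nlinarith
  have key : σ * pw ε (-(1 + σ) / 2) x ≤ rho ε σ x + ε ^ 2 * ‖x‖ ^ 2 * τ := by
    have : rho ε σ x + ε ^ 2 * ‖x‖ ^ 2 * τ = σ * pw ε (-(1 + σ) / 2) x +
      (2 * pw ε (-1 / 2 - 1) x - (1 + σ) * pw ε (-(1 + σ) / 2 - 1) x) := by
      unfold rho; rw [hτ, ← b1, ← b2]; ring
    rw [this]; nlinarith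
  rw [hsum]
  have h5 : ε ^ 2 * τ * (‖x‖ ^ 2 * S) ≤ ε ^ 2 * τ * ‖∑ i, x i • p i‖ ^ 2 :=
    mul_le_mul_of_nonpos_left hcs (mul_nonpos_of_nonneg_of_nonpos (sq_nonneg _) hτ0)
  have h6 := mul_le_mul_of_nonneg_right key hS
  linarith

lemma XX_le {n : ℕ} (ε σ : ℝ) (hε : 0 < ε) (hσ : 0 < σ) (j : Fin n) (x : Euc n) :
    |XX ε σ j x| ≤ 2 / ε := by
  have a0 := pw_pos ε (-1 / 2) x
  have a1 := pw_pos ε (-(1 + σ) / 2) x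
  have a2 : pw ε (-(1 + σ) / 2) x ≤ pw ε (-1 / 2) x := pw_le ε (by linarith) x
  have hr : |rho ε σ x| ≤ 2 * pw ε (-1 / 2) x := by
    unfold rho; rw [abs_le]; constructor <;> linarith
  have hx : |x j| * (ε * pw ε (-1 / 2) x) ≤ 1 := by
    have h0 := one_le_q ε x
    have h1 : pw ε (-1 / 2) x ^ 2 * (1 + ε ^ 2 * ‖x‖ ^ 2) = 1 := by
      unfold pw
      rw [← Real.rpow_natCast, ← Real.rpow_mul (by linarith)]
      norm_num
      rw [Real.rpow_neg_one]
      exact inv_mul_cancel₀ (by linarith)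
    have h2 := coord_sq_le x j
    have h3 : (|x j| * (ε * pw ε (-1 / 2) x)) ^ 2 ≤ 1 ^ 2 := by
      rw [mul_pow, sq_abs, mul_pow]
      have : 0 ≤ ε ^ 2 * pw ε (-1 / 2) x ^ 2 := by positivity
      nlinarith
    exact (le_abs_self _).trans (abs_le_of_sq_le_sq h3 zero_le_one)
  unfold XX
  rw [abs_mul, le_div_iff₀ hε]
  calc |x j| * |rho ε σ x| * ε ≤ |x j| * (2 * pw ε (-1 / 2) x) * ε := by gcongr
    _ = 2 * (|x j| * (ε * pw ε (-1 / 2) x)) := by ring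
    _ ≤ _ := by linarith

lemma dvX_le {n : ℕ} (ε σ : ℝ) (hσ : 0 < σ) (x : Euc n) :
    |dvX ε σ x| ≤ 3 * n + 6 + 2 * σ := by
  have b : ∀ a : ℝ, a ≤ 0 → |pw ε a x| ≤ 1 := fun a ha => by
    rw [abs_of_pos (pw_pos ε a x)]; exact (pw_le ε ha x).trans (pw_zero ε x).le
  have c : ∀ k a : ℝ, a ≤ 0 → |k * pw ε a x| ≤ |k| := fun k a ha => by
    rw [abs_mul]; exact mul_le_of_le_one_right (abs_nonneg _) (b a ha)
  unfold dvX
  refine (abs_add_le _ _).trans ?_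
  have h1 := abs_add_le ((2 * n - 2) * pw ε (-1 / 2) x) (2 * pw ε (-1 / 2 - 1) x)
  have h2 := abs_add_le ((1 + σ - n) * pw ε (-(1 + σ) / 2) x)
    ((-(1 + σ)) * pw ε (-(1 + σ) / 2 - 1) x)
  have d1 := c (2 * n - 2) (-1/2) (by norm_num)
  have d2 := c 2 (-1/2-1) (by norm_num)
  have d3 := c (1 + σ - n) (-(1+σ)/2) (by linarith)
  have d4 := c (-(1 + σ)) (-(1+σ)/2-1) (by linarith)
  have hn : (0 : ℝ) ≤ n := Nat.cast_nonneg n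
  have e1 : |(2 * n - 2 : ℝ)| ≤ 2 * n + 2 := by rw [abs_le]; constructor <;> linarith
  have e2 : |(1 + σ - n : ℝ)| ≤ 1 + σ + n := by rw [abs_le]; constructor <;> linarith
  have e3 : |(-(1 + σ) : ℝ)| ≤ 1 + σ := by rw [abs_le]; constructor <;> linarith
  have e4 : |(2 : ℝ)| = 2 := abs_two
  linarith


lemma mora1 (n : ℕ) (σ : ℝ) (hσ : 0 < σ) (hσ1 : σ ≤ 1) : ∃ K : ℝ, 0 ≤ K ∧
    ∀ (ε : ℝ) (u : 𝓢(Euc n, ℂ)),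
    σ * ∑ i, BF (pw ε (-(1 + σ) / 2)) (Dd i u) (Dd i u) ≤
      ∑ j, BF (XX ε σ j) (AL u) (Dd j u) + 1 / 2 * BF (dvX ε σ) (AL u) u +
        K * ε ^ 2 * BF (pw ε (-(1 + σ) / 2)) u u := by
  set k : ℝ → ℝ := fun a => n * (2 * |a| + 4 * |a| * |a - 1|) with hk
  have hk0 : ∀ a, 0 ≤ k a := fun a => by rw [hk]; positivity
  refine ⟨|(2 * n - 2 : ℝ)| * k (-1 / 2) + |(2 : ℝ)| * k (-1 / 2 - 1) +
    (|(1 + σ - n : ℝ)| * k (-(1 + σ) / 2) + |(-(1 + σ) : ℝ)| * k (-(1 + σ) / 2 - 1)), ?_, ?_⟩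
  · have := hk0 (-1/2); have := hk0 (-1/2-1); have := hk0 (-(1 + σ) / 2)
    have := hk0 (-(1 + σ) / 2 - 1)
    positivity
  intro ε u
  have hm := morawetz (XX_tg ε σ) (dXX_tg ε σ) (XX_line ε σ) (dvX_eq ε σ) u
  have hpos : σ * ∑ i, BF (pw ε (-(1 + σ) / 2)) (Dd i u) (Dd i u) ≤
      ∑ j, ∑ i, BF (dXX ε σ i j) (Dd i u) (Dd j u) := by
    unfold BF
    have i1 : ∀ i, Integrable (fun x => pw ε (-(1 + σ) / 2) x * inner ℝ (Dd i u x) (Dd i u x)) :=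
      fun i => BF_integrable (pw_tg _ _) _ _
    have i2 : ∀ i j, Integrable (fun x => dXX ε σ i j x * inner ℝ (Dd i u x) (Dd j u x)) :=
      fun i j => BF_integrable (dXX_tg _ _ i j) _ _
    rw [← integral_finsetSum _ (fun i _ => i1 i), ← integral_const_mul]
    simp_rw [← integral_finsetSum Finset.univ (fun i _ => i2 i _)]
    rw [← integral_finsetSum _ (fun j _ => integrable_finsetSum _ (fun i _ => i2 i j))]
    refine integral_mono ((integrable_finsetSum _ (fun i _ => i1 i)).const_mul _)
      (integrable_finsetSum _ (fun j _ => integrable_finsetSum _ (fun i _ => i2 i j))) fun x => ?_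
    have := dXX_pos ε σ hσ hσ1 x (fun i => Dd i u x)
    simp only [real_inner_self_eq_norm_sq]
    rw [Finset.mul_sum] at this
    exact this
  have hE : ∀ c a : ℝ, a - 1 ≤ -(1 + σ) / 2 →
      c * ∑ i, BF (pw ε a) (Dd i u) (Dd i u) ≤ c * BF (pw ε a) (AL u) u +
        |c| * k a * ε ^ 2 * BF (pw ε (-(1 + σ) / 2)) u u := by
    intro c a ha
    have h := BF_pw_AL ε a _ ha u
    have h2 := mul_le_mul_of_nonneg_left h (abs_nonneg c)
    rw [← abs_mul] at h2
    have h3 := (abs_le.1 h2).1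
    rw [hk]
    dsimp only
    linarith
  have hdv : ∀ v w : 𝓢(Euc n, ℂ), BF (dvX ε σ) v w =
      ((2 * n - 2) * BF (pw ε (-1 / 2)) v w + 2 * BF (pw ε (-1 / 2 - 1)) v w) +
      ((1 + σ - n) * BF (pw ε (-(1 + σ) / 2)) v w +
        (-(1 + σ)) * BF (pw ε (-(1 + σ) / 2 - 1)) v w) := by
    intro v w
    have h1 := pw_tg (n := n) ε (-1 / 2)
    have h2 := pw_tg (n := n) ε (-(1 + σ) / 2)
    have h3 := pw_tg (n := n) ε (-1 / 2 - 1)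
    have h4 := pw_tg (n := n) ε (-(1 + σ) / 2 - 1)
    unfold dvX
    rw [BF_add_weight (by fun_prop) (by fun_prop), BF_add_weight (by fun_prop) (by fun_prop),
      BF_add_weight (by fun_prop) (by fun_prop)]
    simp only [BF_smul_weight]
  have hsum : ∑ i, BF (dvX ε σ) (Dd i u) (Dd i u) ≤ BF (dvX ε σ) (AL u) u +
    (|(2 * n - 2 : ℝ)| * k (-1 / 2) + |(2 : ℝ)| * k (-1 / 2 - 1) +
    (|(1 + σ - n : ℝ)| * k (-(1 + σ) / 2) + |(-(1 + σ) : ℝ)| * k (-(1 + σ) / 2 - 1))) * ε ^ 2 *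
      BF (pw ε (-(1 + σ) / 2)) u u := by
    simp_rw [hdv, Finset.sum_add_distrib, ← Finset.mul_sum]
    have e1 := hE (2 * n - 2) (-1 / 2) (by linarith)
    have e2 := hE 2 (-1 / 2 - 1) (by linarith)
    have e3 := hE (1 + σ - n) (-(1 + σ) / 2) (by linarith)
    have e4 := hE (-(1 + σ)) (-(1 + σ) / 2 - 1) (by linarith)
    linarith
  have hU : 0 ≤ BF (pw ε (-(1 + σ) / 2)) u u := BF_nonneg (fun x => (pw_pos _ _ x).le) u
  have hKU : 0 ≤ (|(2 * n - 2 : ℝ)| * k (-1 / 2) + |(2 : ℝ)| * k (-1 / 2 - 1) +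
    (|(1 + σ - n : ℝ)| * k (-(1 + σ) / 2) + |(-(1 + σ) : ℝ)| * k (-(1 + σ) / 2 - 1))) * ε ^ 2 *
      BF (pw ε (-(1 + σ) / 2)) u u := by
    have := hk0 (-1/2); have := hk0 (-1/2-1); have := hk0 (-(1 + σ) / 2)
    have := hk0 (-(1 + σ) / 2 - 1)
    positivity
  linarith

/-- multiplication by `i` -/
def JJ {n : ℕ} (u : 𝓢(Euc n, ℂ)) : 𝓢(Euc n, ℂ) := Complex.I • u

lemma JJ_apply {n : ℕ} (u : 𝓢(Euc n, ℂ)) (x : Euc n) : JJ u x = Complex.I * u x := rfl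

lemma BF_JJ_self {n : ℕ} (φ : Euc n → ℝ) (u : 𝓢(Euc n, ℂ)) : BF φ (JJ u) u = 0 := by
  unfold BF
  rw [← integral_zero (Euc n) ℝ (μ := volume)]
  congr 1; ext x
  rw [JJ_apply, Complex.inner]
  simp; try (right; ring)

lemma BF_JJ_JJ {n : ℕ} (φ : Euc n → ℝ) (u v : 𝓢(Euc n, ℂ)) : BF φ (JJ u) (JJ v) = BF φ u v := by
  unfold BF
  congr 1; ext x
  rw [JJ_apply, JJ_apply, Complex.inner, Complex.inner]
  simp <;> ring_nf <;> simp

lemma Dd_JJ {n : ℕ} (i : Fin n) (u : 𝓢(Euc n, ℂ)) : Dd i (JJ u) = JJ (Dd i u) := by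
  unfold JJ Dd
  rw [LineDeriv.lineDerivOp_smul]

/-- `(-Δ - z) u` -/
def ff {n : ℕ} (z : ℂ) (u : 𝓢(Euc n, ℂ)) : 𝓢(Euc n, ℂ) := AL u - z • u

lemma AL_eq {n : ℕ} (z : ℂ) (u : 𝓢(Euc n, ℂ)) : AL u = ff z u + (z.re • u + z.im • JJ u) := by
  ext x
  simp only [ff, _root_.add_apply, _root_.sub_apply, _root_.smul_apply, JJ_apply, smul_eq_mul,
    Complex.real_smul]
  nth_rewrite 1 [← Complex.re_add_im z]
  ring

lemma BF_AL_ff {n : ℕ} {φ : Euc n → ℝ} (hφ : φ.HasTemperateGrowth) (z : ℂ) (u v : 𝓢(Euc n, ℂ)) :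
    BF φ (AL u) v = BF φ (ff z u) v + (z.re * BF φ u v + z.im * BF φ (JJ u) v) := by
  conv_lhs => rw [AL_eq z u]
  rw [BF_add_left hφ, BF_add_left hφ, BF_smul_left, BF_smul_left]

lemma mora2 (n : ℕ) (σ : ℝ) (hσ : 0 < σ) (hσ1 : σ ≤ 1) : ∃ K : ℝ, 0 ≤ K ∧
    ∀ (ε : ℝ) (z : ℂ) (u : 𝓢(Euc n, ℂ)),
    σ * ∑ i, BF (pw ε (-(1 + σ) / 2)) (Dd i u) (Dd i u) ≤
      ∑ j, BF (XX ε σ j) (ff z u) (Dd j u) + 1 / 2 * BF (dvX ε σ) (ff z u) u +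
        z.im * ∑ j, BF (XX ε σ j) (JJ u) (Dd j u) +
        K * ε ^ 2 * BF (pw ε (-(1 + σ) / 2)) u u := by
  obtain ⟨K, hK, h⟩ := mora1 n σ hσ hσ1
  refine ⟨K, hK, fun ε z u => (h ε u).trans (le_of_eq ?_)⟩
  simp_rw [fun j => BF_AL_ff (XX_tg ε σ j) z u (Dd j u), BF_AL_ff (dvX_tg ε σ) z u u, BF_JJ_self]
  have h2 : BF (dvX ε σ) u u = ∑ j, BF (dXX ε σ j j) u u := by
    unfold BF
    rw [← integral_finsetSum _ (fun j _ => BF_integrable (dXX_tg ε σ j j) _ _)]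
    congr 1; ext x; rw [dvX_eq, Finset.sum_mul]
  have h3 : ∀ j, BF (XX ε σ j) u (Dd j u) = -(1 / 2) * BF (dXX ε σ j j) u u := by
    intro j
    have := BF_ibp (XX_tg ε σ j) (dXX_tg ε σ j j) (ev j) (XX_line ε σ j j) u u
    rw [BF_symm _ (∂_{ev j} u)] at this
    change BF _ u (Dd j u) + BF _ u (Dd j u) + _ = 0 at this
    linarith
  simp only [Finset.sum_add_distrib, ← Finset.mul_sum, h3, h2]
  ring

lemma energy_im {n : ℕ} (z : ℂ) (u : 𝓢(Euc n, ℂ)) :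
    BF (fun _ => 1) (ff z u) (JJ u) = - z.im * BF (fun _ => 1) u u := by
  have h := BF_AL_ff (φ := fun _ : Euc n => (1 : ℝ)) (by fun_prop) z u (JJ u)
  rw [BF_one_AL, BF_JJ_JJ, BF_symm _ u (JJ u), BF_JJ_self] at h
  have : ∀ i, BF (fun _ => 1) (Dd i u) (Dd i (JJ u)) = 0 := by
    intro i; rw [Dd_JJ, BF_symm, BF_JJ_self]
  simp only [this, Finset.sum_const_zero] at h
  linarith

lemma energy_re {n : ℕ} (z : ℂ) (u : 𝓢(Euc n, ℂ)) :
    BF (fun _ => 1) (ff z u) u =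
      ∑ i, BF (fun _ => 1) (Dd i u) (Dd i u) - z.re * BF (fun _ => 1) u u := by
  have h := BF_AL_ff (φ := fun _ : Euc n => (1 : ℝ)) (by fun_prop) z u u
  rw [BF_one_AL, BF_JJ_self] at h
  linarith

lemma sqrt_pw {n : ℕ} (ε a b : ℝ) (hab : a + b = 0) (x : Euc n) :
    √(pw ε a x) * √(pw ε b x) = 1 := by
  rw [← Real.sqrt_mul (pw_pos _ _ _).le]
  unfold pw
  rw [← Real.rpow_add (by have := one_le_q ε x; linarith), hab]
  simp

set_option maxHeartbeats 2000000 in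
/-- scalar closing lemma -/
lemma closing (σ δ K1 K2 M η : ℝ) (hσ : 0 < σ) (hδ : 0 < δ) (hM : 0 ≤ M)
    (hη : (K1 + 2 * K2 / σ) * η ≤ δ / 4) :
    ∃ C : ℝ, 0 < C ∧ ∀ a b r U G N Z D : ℝ, r ^ 2 = a ^ 2 + b ^ 2 → δ ≤ r →
      0 ≤ U → 0 ≤ G → 0 ≤ N → 0 ≤ Z → 0 ≤ D → U ^ 2 ≤ Z → |b| * Z ≤ N * U →
      D - a * Z ≤ N * U → a * U ^ 2 ≤ G ^ 2 + K1 * η * U ^ 2 + N * U →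
      σ * G ^ 2 ≤ K2 * η * U ^ 2 + M * N * G + M * N * U + M * (|b| * (√Z * √D)) →
      r * U ^ 2 ≤ C * N ^ 2 := by
  set c1 : ℝ := (1 + 2 * M / σ) / √δ + 4 * M / σ with hc1
  set c2 : ℝ := M ^ 2 / σ ^ 2 with hc2
  have hc10 : 0 ≤ c1 := by positivity
  have hc20 : 0 ≤ c2 := by positivity
  refine ⟨4 / δ + (16 * c1 ^ 2 + 8 * c2), by positivity, ?_⟩
  intro a b r U G N Z D hr hδr hU hG hN hZ hD hUZ hb hD2 h3 h4
  have hr0 : 0 < r := by linarith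
  have hN2 : 0 ≤ N ^ 2 := sq_nonneg N
  have hTot : ∀ Q : ℝ, Q ≤ 4 / δ * N ^ 2 ∨ Q ≤ (16 * c1 ^ 2 + 8 * c2) * N ^ 2 →
      Q ≤ (4 / δ + (16 * c1 ^ 2 + 8 * c2)) * N ^ 2 := by
    intro Q hQ
    have p1 : 0 ≤ 4 / δ * N ^ 2 := by positivity
    have p2 : 0 ≤ (16 * c1 ^ 2 + 8 * c2) * N ^ 2 := by positivity
    rcases hQ with h | h <;> linarith
  apply hTot
  have elliptic : r / 2 * Z ≤ N * U → r * U ^ 2 ≤ 4 / δ * N ^ 2 := by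
    intro h
    have h1 : r / 2 * U ^ 2 ≤ N * U := (mul_le_mul_of_nonneg_left hUZ (by positivity)).trans h
    have h2 : r * U ≤ 2 * N := by
      rcases hU.eq_or_lt with h0 | h0
      · rw [← h0]; linarith
      · have : (r * U) * U ≤ (2 * N) * U := by nlinarith
        exact le_of_mul_le_mul_right this h0
    have h3 : (r * U) ^ 2 ≤ (2 * N) ^ 2 := pow_le_pow_left₀ (by positivity) h2 2
    have h4 : δ * (r * U ^ 2) ≤ 4 * N ^ 2 := by
      calc δ * (r * U ^ 2) ≤ r * (r * U ^ 2) := by gcongr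
        _ = (r * U) ^ 2 := by ring
        _ ≤ _ := by rw [mul_pow] at h3; linarith
    rw [div_mul_eq_mul_div, le_div_iff₀ hδ]; linarith
  by_cases ca : r / 2 ≤ a
  · right
    have hbr : |b| ≤ r := abs_le_of_sq_le_sq (by rw [hr]; linarith [sq_nonneg a]) hr0.le
    have har : a ≤ r := (le_abs_self a).trans (abs_le_of_sq_le_sq (by rw [hr]; linarith [sq_nonneg b]) hr0.le)
    have hNU : 0 ≤ N * U := by positivity
    set s := √r with hs
    have hss : s ^ 2 = r := Real.sq_sqrt hr0.le
    have hs0 : 0 < s := Real.sqrt_pos.2 hr0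
    have hflux : |b| * (√Z * √D) ≤ 2 * s * (N * U) := by
      have hb0 := abs_nonneg b
      refine (pow_le_pow_iff_left₀ (by positivity) ?_ two_ne_zero).1 ?_
      · positivity
      · have : (|b| * (√Z * √D)) ^ 2 = (|b| * Z) * (|b| * D) := by
          rw [mul_pow, mul_pow, Real.sq_sqrt hZ, Real.sq_sqrt hD]; ring
        rw [this]
        have q1 : |b| * D ≤ 2 * r * (N * U) := by
          have : |b| * D ≤ |b| * (a * Z + N * U) := by gcongr; linarith
          have q2 : a * (|b| * Z) ≤ r * (N * U) :=
            mul_le_mul har hb (by positivity) hr0.le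
          have q3 : |b| * (N * U) ≤ r * (N * U) := by gcongr
          linarith
        calc (|b| * Z) * (|b| * D) ≤ (N * U) * (2 * r * (N * U)) := by
              apply mul_le_mul hb q1 (by positivity) hNU
          _ ≤ (2 * s * (N * U)) ^ 2 := by
              have : (2 * s * (N * U)) ^ 2 = 4 * s ^ 2 * (N * U) ^ 2 := by ring
              rw [this, hss]; nlinarith [mul_nonneg hr0.le (sq_nonneg (N * U))]
    -- gradient bound
    have hG2 : G ^ 2 ≤ 2 / σ * (K2 * η * U ^ 2 + M * N * U + 2 * M * s * (N * U)) +
        M ^ 2 / σ ^ 2 * N ^ 2 := by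
      have y1 : M * N * G ≤ σ / 2 * G ^ 2 + M ^ 2 / (2 * σ) * N ^ 2 := by
        have := sq_nonneg (σ * G - M * N)
        have e : σ / 2 * G ^ 2 + M ^ 2 / (2 * σ) * N ^ 2 - M * N * G =
          (σ * G - M * N) ^ 2 / (2 * σ) := by field_simp; ring
        have : 0 ≤ (σ * G - M * N) ^ 2 / (2 * σ) := by positivity
        linarith
      have y2 : M * (|b| * (√Z * √D)) ≤ M * (2 * s * (N * U)) := by gcongr
      have y3 : σ / 2 * G ^ 2 ≤ K2 * η * U ^ 2 + M * N * U + 2 * M * s * (N * U) +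
        M ^ 2 / (2 * σ) * N ^ 2 := by linarith
      have y4 := mul_le_mul_of_nonneg_left y3 (show 0 ≤ 2 / σ by positivity)
      have e1 : 2 / σ * (σ / 2 * G ^ 2) = G ^ 2 := by field_simp
      have e2 : 2 / σ * (M ^ 2 / (2 * σ) * N ^ 2) = M ^ 2 / σ ^ 2 * N ^ 2 := by field_simp
      rw [e1, mul_add, e2] at y4
      exact y4
    have hmain : r / 4 * U ^ 2 ≤ (1 + 2 * M / σ) * (N * U) + 4 * M / σ * (s * (N * U)) +
        c2 * N ^ 2 := by
      have w1 : r / 2 * U ^ 2 ≤ a * U ^ 2 := by gcongr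
      have w2 : (K1 + 2 * K2 / σ) * η * U ^ 2 ≤ r / 4 * U ^ 2 := by
        gcongr; linarith
      have e : 2 / σ * (K2 * η * U ^ 2 + M * N * U + 2 * M * s * (N * U)) =
        2 * K2 / σ * η * U ^ 2 + 2 * M / σ * (N * U) + 4 * M / σ * (s * (N * U)) := by ring
      rw [e] at hG2
      linarith
    set Y := s * U with hY
    have hY2 : Y ^ 2 = r * U ^ 2 := by rw [hY, mul_pow, hss]
    have hNUY : N * U ≤ N * Y / √δ := by
      rw [le_div_iff₀ (Real.sqrt_pos.2 hδ)]
      have : √δ ≤ s := Real.sqrt_le_sqrt hδr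
      calc N * U * √δ ≤ N * U * s := by gcongr
        _ = _ := by rw [hY]; ring
    have hfin : Y ^ 2 / 4 ≤ c1 * (N * Y) + c2 * N ^ 2 := by
      have : (1 + 2 * M / σ) * (N * U) ≤ (1 + 2 * M / σ) * (N * Y / √δ) := by gcongr
      have e : c1 * (N * Y) = (1 + 2 * M / σ) * (N * Y / √δ) + 4 * M / σ * (s * (N * U)) := by
        rw [hc1, hY]; ring
      rw [hY2, e]; linarith
    rw [← hY2]
    nlinarith [sq_nonneg (Y - 4 * c1 * N)]
  · left
    push Not at ca
    apply elliptic
    by_cases cb : r / 2 ≤ |b|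
    · exact (mul_le_mul_of_nonneg_right cb hZ).trans hb
    · push Not at cb
      have ca2 : a ≤ -(r / 2) := by
        by_contra hcon
        push Not at hcon
        have : b ^ 2 < (r / 2) ^ 2 := by
          rw [← sq_abs]; exact pow_lt_pow_left₀ cb (abs_nonneg b) two_ne_zero
        nlinarith
      have := mul_le_mul_of_nonneg_right ca2 hZ
      linarith


lemma sum_sqrt_le {n : ℕ} (g : Fin n → ℝ) (hg : ∀ i, 0 ≤ g i) :
    ∑ i, √(g i) ≤ n * √(∑ i, g i) := by
  have : ∀ i ∈ Finset.univ, √(g i) ≤ √(∑ i, g i) := fun i hi =>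
    Real.sqrt_le_sqrt (Finset.single_le_sum (fun i _ => hg i) hi)
  simpa using Finset.sum_le_card_nsmul _ _ _ this

set_option maxHeartbeats 2000000 in
lemma lap_est (n : ℕ) (s δ : ℝ) (hs : 1 / 2 < s) (hδ : 0 < δ) :
    ∃ C : ℝ, 0 < C ∧ ∀ z : ℂ, δ ≤ ‖z‖ → ∀ u : 𝓢(Euc n, ℂ),
      ‖z‖ * BF (pw 1 (-s)) u u ≤ C * BF (pw 1 s) (ff z u) (ff z u) := by
  set σ : ℝ := min 1 (2 * s - 1) with hσdef
  have hσ : 0 < σ := lt_min one_pos (by linarith)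
  have hσ1 : σ ≤ 1 := min_le_left _ _
  have hσs : (1 + σ) / 2 ≤ s := by
    have := min_le_right 1 (2 * s - 1)
    rw [← hσdef] at this
    linarith
  obtain ⟨K2, hK2, hmora⟩ := mora2 n σ hσ hσ1
  set a0 : ℝ := -(1 + σ) / 2 with ha0
  have ha00 : a0 ≤ 0 := by rw [ha0]; linarith
  set K1 : ℝ := n * (2 * |a0| + 4 * |a0| * |a0 - 1|) with hK1
  have hK10 : 0 ≤ K1 := by positivity
  set T : ℝ := K1 + 2 * K2 / σ with hT
  have hT0 : 0 ≤ T := by positivity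
  set η : ℝ := min 1 (δ / (4 * (T + 1))) with hηdef
  have hη0 : 0 < η := lt_min one_pos (by positivity)
  have hη1 : η ≤ 1 := min_le_left _ _
  have hηT : T * η ≤ δ / 4 := by
    have h1 : η ≤ δ / (4 * (T + 1)) := min_le_right _ _
    rw [le_div_iff₀ (by positivity)] at h1
    nlinarith
  set ε : ℝ := √η with hεdef
  have hε : 0 < ε := Real.sqrt_pos.2 hη0
  have hεη : ε ^ 2 = η := Real.sq_sqrt hη0.le
  set M1 : ℝ := 2 / ε with hM1
  set M2 : ℝ := 3 * n + 6 + 2 * σ with hM2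
  have hM10 : 0 ≤ M1 := by positivity
  have hM20 : 0 ≤ M2 := by positivity
  set M : ℝ := n * M1 + M2 with hM
  obtain ⟨C, hC, hclose⟩ := closing σ δ K1 K2 M η hσ hδ (by positivity) hηT
  refine ⟨C, hC, fun z hz u => ?_⟩
  set f := ff z u with hf
  have tgw := pw_tg (n := n) ε a0
  have tgw' := pw_tg (n := n) ε (-a0)
  have tg1 : (fun _ : Euc n => (1 : ℝ)).HasTemperateGrowth := by fun_prop
  have w0 : ∀ x : Euc n, 0 ≤ pw ε a0 x := fun x => (pw_pos _ _ x).le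
  have w0' : ∀ x : Euc n, 0 ≤ pw ε (-a0) x := fun x => (pw_pos _ _ x).le
  have w1 : ∀ x : Euc n, pw ε a0 x ≤ 1 := fun x => (pw_le ε ha00 x).trans (pw_zero ε x).le
  have hU2 := BF_nonneg w0 u
  have hN2 := BF_nonneg w0' f
  have hGi : ∀ i, 0 ≤ BF (pw ε a0) (Dd i u) (Dd i u) := fun i => BF_nonneg w0 _
  have hG2 : 0 ≤ ∑ i, BF (pw ε a0) (Dd i u) (Dd i u) := Finset.sum_nonneg fun i _ => hGi i
  have hZ := BF_nonneg (φ := fun _ : Euc n => (1 : ℝ)) (fun _ => zero_le_one) u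
  have hDi : ∀ i, 0 ≤ BF (fun _ => 1) (Dd i u) (Dd i u) := fun i => BF_nonneg (fun _ => zero_le_one) _
  have hD : 0 ≤ ∑ i, BF (fun _ => 1) (Dd i u) (Dd i u) := Finset.sum_nonneg fun i _ => hDi i
  have cs : ∀ {φ : Euc n → ℝ} (_ : φ.HasTemperateGrowth) (K : ℝ), 0 ≤ K → (∀ x, |φ x| ≤ K) →
      ∀ v, |BF φ f v| ≤ K * (√(BF (pw ε (-a0)) f f) * √(BF (pw ε a0) v v)) := by
    intro φ hφ K hK h v
    refine BF_cs hφ tgw' tgw K hK w0' w0 (fun x => ?_) f v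
    rw [sqrt_pw ε (-a0) a0 (by ring), mul_one]
    exact h x
  have cs1 : ∀ {φ : Euc n → ℝ} (_ : φ.HasTemperateGrowth) (K : ℝ), 0 ≤ K → (∀ x, |φ x| ≤ K) →
      ∀ v w, |BF φ v w| ≤ K * (√(BF (fun _ => 1) v v) * √(BF (fun _ => 1) w w)) := by
    intro φ hφ K hK h v w
    refine BF_cs hφ tg1 tg1 K hK (fun _ => zero_le_one) (fun _ => zero_le_one) (fun x => ?_) v w
    simpa using h x
  set N := √(BF (pw ε (-a0)) f f) with hN
  set U := √(BF (pw ε a0) u u) with hU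
  set G := √(∑ i, BF (pw ε a0) (Dd i u) (Dd i u)) with hG
  set Z := BF (fun _ => 1) u u with hZd
  set D := ∑ i, BF (fun _ => 1) (Dd i u) (Dd i u) with hDd
  have hUsq : U ^ 2 = BF (pw ε a0) u u := Real.sq_sqrt hU2
  have hNsq : N ^ 2 = BF (pw ε (-a0)) f f := Real.sq_sqrt hN2
  have hGsq : G ^ 2 = ∑ i, BF (pw ε a0) (Dd i u) (Dd i u) := Real.sq_sqrt hG2
  have hU0 : 0 ≤ U := Real.sqrt_nonneg _
  have hN0 : 0 ≤ N := Real.sqrt_nonneg _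
  have hG0 : 0 ≤ G := Real.sqrt_nonneg _
  have res := hclose z.re z.im ‖z‖ U G N Z D
    (by rw [Complex.sq_norm, Complex.normSq_apply]; ring) hz hU0 hG0 hN0 hZ hD
    (by rw [hUsq]; exact BF_mono tgw tg1 w1 u)
    (by
      have h1 := cs tg1 1 zero_le_one (fun x => by simp) (JJ u)
      rw [BF_JJ_JJ, energy_im, abs_mul, abs_neg, abs_of_nonneg hZ, one_mul] at h1
      exact h1)
    (by
      have h1 := cs tg1 1 zero_le_one (fun x => by simp) u
      rw [hf, energy_re, one_mul] at h1
      exact (le_abs_self _).trans h1)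
    (by
      have h1 := BF_pw_AL ε a0 a0 (by linarith) u
      have h2 := cs tgw 1 zero_le_one (fun x => by rw [abs_of_nonneg (w0 x)]; exact w1 x) u
      rw [BF_AL_ff tgw z u u, BF_JJ_self, ← hGsq, ← hUsq, hεη] at h1
      have h3 := (abs_le.1 h1).2
      have h4 := (abs_le.1 h2).1
      rw [one_mul] at h4
      rw [← hf] at h3
      linarith)
    (by
      have h1 := hmora ε z u
      rw [← hGsq, ← hUsq, hεη, ← hf] at h1
      have t1 : ∑ j, BF (XX ε σ j) f (Dd j u) ≤ n * M1 * N * G := by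
        calc ∑ j, BF (XX ε σ j) f (Dd j u)
            ≤ ∑ j, M1 * (N * √(BF (pw ε a0) (Dd j u) (Dd j u))) :=
              Finset.sum_le_sum fun j _ => (le_abs_self _).trans
                (cs (XX_tg ε σ j) M1 hM10 (XX_le ε σ hε hσ j) _)
          _ = M1 * N * ∑ j, √(BF (pw ε a0) (Dd j u) (Dd j u)) := by
              rw [Finset.mul_sum]; refine Finset.sum_congr rfl fun j _ => ?_; ring
          _ ≤ M1 * N * (n * G) := by
              gcongr; exact sum_sqrt_le _ hGi
          _ = _ := by ring
      have t2 : BF (dvX ε σ) f u ≤ M2 * (N * U) :=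
        (le_abs_self _).trans (cs (dvX_tg ε σ) M2 hM20 (dvX_le ε σ hσ) u)
      have t3 : z.im * ∑ j, BF (XX ε σ j) (JJ u) (Dd j u) ≤ n * M1 * (|z.im| * (√Z * √D)) := by
        have : |∑ j, BF (XX ε σ j) (JJ u) (Dd j u)| ≤ M1 * √Z * (n * √D) := by
          calc |∑ j, BF (XX ε σ j) (JJ u) (Dd j u)|
              ≤ ∑ j, |BF (XX ε σ j) (JJ u) (Dd j u)| := Finset.abs_sum_le_sum_abs _ _
            _ ≤ ∑ j, M1 * (√Z * √(BF (fun _ => 1) (Dd j u) (Dd j u))) :=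
              Finset.sum_le_sum fun j _ => by
                have := cs1 (XX_tg ε σ j) M1 hM10 (XX_le ε σ hε hσ j) (JJ u) (Dd j u)
                rw [BF_JJ_JJ] at this
                exact this
            _ = M1 * √Z * ∑ j, √(BF (fun _ => 1) (Dd j u) (Dd j u)) := by
              rw [Finset.mul_sum]; refine Finset.sum_congr rfl fun j _ => ?_; ring
            _ ≤ _ := by
              gcongr; exact sum_sqrt_le _ hDi
        calc _ ≤ |z.im * ∑ j, BF (XX ε σ j) (JJ u) (Dd j u)| := le_abs_self _
          _ ≤ |z.im| * (M1 * √Z * (n * √D)) := by rw [abs_mul]; gcongr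
          _ = _ := by ring
      have q1 : 0 ≤ M2 * N * G := by positivity
      have q2 : 0 ≤ n * M1 * N * U := by positivity
      have q3 : 0 ≤ M2 * (|z.im| * (√Z * √D)) := by positivity
      have q4 : 0 ≤ M2 * (N * U) := by positivity
      rw [hM]
      linarith)
  rw [hUsq, hNsq] at res
  have hq : ∀ x : Euc n, 1 + ε ^ 2 * ‖x‖ ^ 2 ≤ 1 + (1 : ℝ) ^ 2 * ‖x‖ ^ 2 := fun x => by
    rw [hεη]; gcongr; simpa using hη1
  have m1 : BF (pw 1 (-s)) u u ≤ BF (pw ε a0) u u := by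
    refine BF_mono (pw_tg _ _) tgw (fun x => ?_) u
    refine (pw_le 1 (show -s ≤ a0 by rw [ha0]; linarith) x).trans ?_
    exact Real.rpow_le_rpow_of_nonpos (by have := one_le_q ε x; linarith) (hq x) ha00
  have m2 : BF (pw ε (-a0)) f f ≤ BF (pw 1 s) f f := by
    refine BF_mono tgw' (pw_tg _ _) (fun x => ?_) f
    refine le_trans ?_ (pw_le 1 (show -a0 ≤ s by rw [ha0]; linarith) x)
    exact Real.rpow_le_rpow (by have := one_le_q ε x; linarith) (hq x) (by linarith)
  calc ‖z‖ * BF (pw 1 (-s)) u u ≤ ‖z‖ * BF (pw ε a0) u u := by gcongr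
    _ ≤ C * BF (pw ε (-a0)) f f := res
    _ ≤ _ := by gcongr


/-- `-Δ` as a linear map on Schwartz functions. -/
def ALm (n : ℕ) : 𝓢(Euc n, ℂ) →ₗ[ℂ] 𝓢(Euc n, ℂ) where
  toFun := AL
  map_add' u v := by
    simp only [AL, Dd, LineDeriv.lineDerivOp_add, Finset.sum_add_distrib, neg_add]
  map_smul' c u := by
    simp only [AL, Dd, LineDeriv.lineDerivOp_smul, ← Finset.smul_sum, smul_neg, RingHom.id_apply]

lemma negLap_iter {n : ℕ} (m : ℕ) (u : 𝓢(Euc n, ℂ)) :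
    negLap^[m] (⇑u) = ⇑(((ALm n) ^ m) u) := by
  induction m with
  | zero => simp
  | succ k ih =>
    rw [Function.iterate_succ_apply', ih, negLap_eq, pow_succ']
    rfl

lemma eLp_BF {n : ℕ} (t : ℝ) (u : 𝓢(Euc n, ℂ)) :
    eLpNorm (fun x : Euc n => ((1 + ‖x‖ ^ 2) ^ (t / 2) : ℝ) • u x) 2 volume
      = ENNReal.ofReal (√(BF (pw 1 t) u u)) := by
  have hφ := pw_tg (n := n) 1 (t / 2)
  have e : (fun x : Euc n => ((1 + ‖x‖ ^ 2) ^ (t / 2) : ℝ) • u x) =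
      ⇑(SchwartzMap.smulLeftCLM ℂ (pw 1 (t / 2)) u) := by
    funext x
    rw [SchwartzMap.smulLeftCLM_apply_apply hφ]
    simp [pw]
  have hm : MemLp (fun x : Euc n => ((1 + ‖x‖ ^ 2) ^ (t / 2) : ℝ) • u x) 2 volume := by
    rw [e]; exact SchwartzMap.memLp _ 2 volume
  rw [hm.eLpNorm_eq_integral_rpow_norm (by norm_num) (by norm_num), Real.sqrt_eq_rpow]
  congr 1
  have : ∀ x : Euc n, ‖((1 + ‖x‖ ^ 2) ^ (t / 2) : ℝ) • u x‖ ^ (2 : ℝ≥0∞).toReal =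
      pw 1 t x * inner ℝ (u x) (u x) := by
    intro x
    have h0 : 0 ≤ 1 + ‖x‖ ^ 2 := by positivity
    simp only [ENNReal.toReal_ofNat, Real.rpow_ofNat]
    rw [norm_smul, mul_pow, real_inner_self_eq_norm_sq, Real.norm_eq_abs, sq_abs,
      ← Real.rpow_natCast, ← Real.rpow_mul h0]
    simp [pw]
  simp_rw [this]
  unfold BF
  norm_num

lemma BF_csmul {n : ℕ} (φ : Euc n → ℝ) (c : ℂ) (u : 𝓢(Euc n, ℂ)) :
    BF φ (c • u) (c • u) = ‖c‖ ^ 2 * BF φ u u := by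
  unfold BF
  rw [← integral_const_mul]
  congr 1; ext x
  rw [real_inner_self_eq_norm_sq, real_inner_self_eq_norm_sq, _root_.smul_apply, norm_smul]
  ring

open Polynomial in
lemma nodal_roots (m : ℕ) (hm : m ≠ 0) (z : ℂ) (hz : z ≠ 0) :
    ∃ S : Finset ℂ, S.card = m ∧ Lagrange.nodal S id = X ^ m - C z := by
  classical
  have hmo : (X ^ m - C z : ℂ[X]).Monic := monic_X_pow_sub_C z hm
  have hsep : (X ^ m - C z : ℂ[X]).Separable :=
    separable_X_pow_sub_C z (by exact_mod_cast hm) hz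
  have hnd := nodup_roots hsep
  have hsp : (X ^ m - C z : ℂ[X]).Splits := IsAlgClosed.splits _
  refine ⟨(X ^ m - C z : ℂ[X]).roots.toFinset, ?_, ?_⟩
  · rw [Multiset.toFinset_card_of_nodup hnd, ← hsp.natDegree_eq_card_roots]
    exact natDegree_X_pow_sub_C
  · conv_rhs => rw [hsp.eq_prod_roots_of_monic hmo]
    rw [Lagrange.nodal, Finset.prod]
    rw [Multiset.toFinset_val, Multiset.dedup_eq_self.2 hnd]
    simp

open Polynomial in
lemma basis_mul (S : Finset ℂ) (w : ℂ) (hw : w ∈ S) :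
    (X - C w) * Lagrange.basis S id w =
      C ((eval w (derivative (Lagrange.nodal S id)))⁻¹) * Lagrange.nodal S id := by
  classical
  rw [Lagrange.basis_eq_prod_sub_inv_mul_nodal_div hw,
    Lagrange.nodalWeight_eq_eval_derivative_nodal hw,
    ← Lagrange.nodal_erase_eq_nodal_div hw]
  conv_rhs => arg 2; rw [Lagrange.nodal_eq_mul_nodal_erase hw]
  simp only [id]
  ring

/-- High-energy decay estimate: for `s > 1/2` and `δ > 0`,
`‖⟨x⟩^{-s} u‖_{L²} ≤ C |z|^{(1-2m)/(2m)} ‖⟨x⟩^{s} ((-Δ)^m u - z u)‖_{L²}` for all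
`z ∈ ℂ \ [0, ∞)` with `|z| ≥ δ`, for Schwartz `u`. -/
theorem stmt_5 (n m : ℕ) (hm : 2 ≤ m) (hn : 2 * m < n) (s δ : ℝ)
    (hs : 1 / 2 < s) (hδ : 0 < δ) :
    ∃ C : ℝ, 0 < C ∧ ∀ z : ℂ, (z.im ≠ 0 ∨ z.re < 0) → δ ≤ ‖z‖ →
      ∀ u : SchwartzMap (Euc n) ℂ,
      eLpNorm (fun x : Euc n => ((1 + ‖x‖ ^ 2) ^ (-s / 2) : ℝ) • u x) 2 volume
        ≤ ENNReal.ofReal (C * ‖z‖ ^ ((1 - 2 * (m : ℝ)) / (2 * m))) *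
          eLpNorm (fun x : Euc n => ((1 + ‖x‖ ^ 2) ^ (s / 2) : ℝ) •
            ((negLap^[m] ⇑u) x - z * u x)) 2 volume := by
  have hm0 : m ≠ 0 := by omega
  have hmR : (0 : ℝ) < m := by positivity
  obtain ⟨C, hC, hest⟩ := lap_est n s (δ ^ ((m : ℝ)⁻¹)) hs (Real.rpow_pos_of_pos hδ _)
  refine ⟨√C, Real.sqrt_pos.2 hC, fun z _ hzδ u => ?_⟩
  have hz0 : 0 < ‖z‖ := hδ.trans_le hzδ
  obtain ⟨S, hcard, hnod⟩ := nodal_roots m hm0 z (norm_pos_iff.1 hz0)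
  set f : 𝓢(Euc n, ℂ) := ((ALm n) ^ m) u - z • u with hf
  have hfx : (fun x : Euc n => ((1 + ‖x‖ ^ 2) ^ (s / 2) : ℝ) •
      ((negLap^[m] ⇑u) x - z * u x)) =
      fun x : Euc n => ((1 + ‖x‖ ^ 2) ^ (s / 2) : ℝ) • f x := by
    rw [negLap_iter]; rfl
  rw [hfx, eLp_BF s f]
  set v : ℂ → 𝓢(Euc n, ℂ) := fun w => Polynomial.aeval (ALm n) (Lagrange.basis S id w) u with hv
  have hSne : S.Nonempty := by rw [← Finset.card_pos]; omega
  have hsum : u = ∑ w ∈ S, v w := by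
    have h1 := Lagrange.sum_basis (s := S) (v := (id : ℂ → ℂ)) (fun _ _ _ _ h => h) hSne
    have h2 := congrArg (fun p => Polynomial.aeval (ALm n) p u) h1
    simp only [map_sum, map_one, LinearMap.sum_apply] at h2
    exact h2.symm
  have hroot : ∀ w ∈ S, w ^ m = z := by
    intro w hw
    have h1 := Lagrange.eval_nodal_at_node (v := (id : ℂ → ℂ)) hw
    rw [hnod] at h1
    simp only [id, Polynomial.eval_sub, Polynomial.eval_pow, Polynomial.eval_X,
      Polynomial.eval_C] at h1
    exact sub_eq_zero.1 h1
  have hff : ∀ w ∈ S, ff w (v w) = ((m : ℂ) * w ^ (m - 1))⁻¹ • f := by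
    intro w hw
    have h1 := basis_mul S w hw
    rw [hnod] at h1
    have h2 := congrArg (fun p => Polynomial.aeval (ALm n) p u) h1
    simp only [map_mul, map_sub, Polynomial.aeval_X, Polynomial.aeval_C, map_pow,
      Module.End.mul_apply, LinearMap.sub_apply, Module.algebraMap_end_apply,
      Polynomial.derivative_X_pow, Polynomial.derivative_C, Polynomial.eval_sub,
      Polynomial.eval_mul, Polynomial.eval_pow, Polynomial.eval_X, Polynomial.eval_C,
      Polynomial.eval_zero, sub_zero] at h2
    rw [hf, smul_sub]
    exact h2
  have hone : ∀ w ∈ S, √(BF (pw 1 (-s)) (v w) (v w)) ≤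
      (m : ℝ)⁻¹ * (√C * ‖z‖ ^ ((1 - 2 * (m : ℝ)) / (2 * m)) * √(BF (pw 1 s) f f)) := by
    intro w hw
    have hwz : ‖w‖ ^ m = ‖z‖ := by rw [← norm_pow, hroot w hw]
    have hw0 : 0 < ‖w‖ := by
      rcases (norm_nonneg w).eq_or_lt with h | h
      · rw [← h, zero_pow hm0] at hwz; linarith
      · exact h
    have hwr : ‖w‖ = ‖z‖ ^ ((m : ℝ)⁻¹) := by
      rw [← hwz, Real.pow_rpow_inv_natCast hw0.le hm0]
    have h1 := hest w (by rw [hwr]; gcongr) (v w)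
    rw [hff w hw, BF_csmul] at h1
    have hB : 0 ≤ BF (pw 1 s) f f := BF_nonneg (fun x => (pw_pos _ _ x).le) f
    set k : ℝ := ‖z‖ ^ ((1 - 2 * (m : ℝ)) / (2 * m)) with hk
    have hk0 : 0 < k := Real.rpow_pos_of_pos hz0 _
    have hkw : ‖((m : ℂ) * w ^ (m - 1))⁻¹‖ ^ 2 = ‖w‖ * ((m : ℝ)⁻¹ * k) ^ 2 := by
      have hk2 : k ^ 2 * ‖w‖ ^ (2 * m - 1) = 1 := by
        rw [hk, ← Real.rpow_natCast, ← Real.rpow_mul hz0.le, hwr, ← Real.rpow_natCast,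
          ← Real.rpow_mul hz0.le, ← Real.rpow_add hz0,
          Nat.cast_sub (by omega : 1 ≤ 2 * m)]
        convert Real.rpow_zero _ using 2
        push_cast
        field_simp
        ring
      have e1 : 2 * m - 1 = (2 * (m - 1)) + 1 := by omega
      rw [e1, pow_succ ‖w‖, pow_mul' ‖w‖] at hk2
      rw [norm_inv, norm_mul, norm_pow, Complex.norm_natCast]
      have hne : ‖w‖ ^ (m - 1) ≠ 0 := by positivity
      field_simp
      linarith
    rw [hkw] at h1
    have h2 : BF (pw 1 (-s)) (v w) (v w) ≤ ((m : ℝ)⁻¹ * (√C * k * √(BF (pw 1 s) f f))) ^ 2 := by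
      have e : ((m : ℝ)⁻¹ * (√C * k * √(BF (pw 1 s) f f))) ^ 2 =
          C * (((m : ℝ)⁻¹ * k) ^ 2 * BF (pw 1 s) f f) := by
        rw [mul_pow, mul_pow, mul_pow, Real.sq_sqrt hC.le, Real.sq_sqrt hB]; ring
      rw [e]
      refine le_of_mul_le_mul_left (h1.trans (le_of_eq ?_)) hw0
      ring
    rw [← Real.sqrt_sq (show 0 ≤ (m : ℝ)⁻¹ * (√C * k * √(BF (pw 1 s) f f)) by positivity)]
    exact Real.sqrt_le_sqrt h2
  have hfun : (fun x : Euc n => ((1 + ‖x‖ ^ 2) ^ (-s / 2) : ℝ) • u x) =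
      ∑ w ∈ S, fun x : Euc n => ((1 + ‖x‖ ^ 2) ^ (-s / 2) : ℝ) • v w x := by
    funext x
    rw [Finset.sum_apply, ← Finset.smul_sum]
    congr 1
    conv_lhs => rw [hsum]
    rw [_root_.sum_apply]
  rw [hfun]
  have hmeas : ∀ w ∈ S, AEStronglyMeasurable
      (fun x : Euc n => ((1 + ‖x‖ ^ 2) ^ (-s / 2) : ℝ) • v w x) volume := by
    intro w _
    refine Continuous.aestronglyMeasurable ?_
    have hc : Continuous (fun x : Euc n => ((1 + ‖x‖ ^ 2) ^ (-s / 2) : ℝ)) :=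
      Continuous.rpow_const (by fun_prop) fun x => Or.inl (by positivity)
    exact hc.smul (v w).continuous
  refine (eLpNorm_sum_le hmeas (by norm_num)).trans ?_
  rw [← ENNReal.ofReal_mul (by positivity)]
  calc ∑ w ∈ S, eLpNorm (fun x : Euc n => ((1 + ‖x‖ ^ 2) ^ (-s / 2) : ℝ) • v w x) 2 volume
      ≤ ∑ w ∈ S, ENNReal.ofReal ((m : ℝ)⁻¹ *
        (√C * ‖z‖ ^ ((1 - 2 * (m : ℝ)) / (2 * m)) * √(BF (pw 1 s) f f))) := by
        refine Finset.sum_le_sum fun w hw => ?_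
        rw [eLp_BF (-s)]
        exact ENNReal.ofReal_le_ofReal (hone w hw)
    _ = _ := by
        rw [Finset.sum_const, hcard, nsmul_eq_mul, ← ENNReal.ofReal_natCast,
          ← ENNReal.ofReal_mul hmR.le, mul_inv_cancel_left₀ hmR.ne']
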